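/- Let (X,H,ν) be a categorical augmented rack with X cocommutative (τ∘Δ_X = Δ_X). Define the R-matrix R : X⊗X → X⊗X by R(x⊗y) = y⁽¹⁾ ⊗ (x·ν(y⁽²⁾)). Then R satisfies the Yang–Baxter equation: (R⊗1)∘(1⊗R)∘(R⊗1) = (1⊗R)∘(R⊗1)∘(1⊗R) as linear maps X⊗X⊗X → X⊗X⊗X. -/

import Mathlib

open TensorProduct

/-- `sandwich a` is the linear map `H ⊗ H → H` sending `g⁽¹⁾ ⊗ g⁽²⁾` to `S(g⁽¹⁾) * a * g⁽²⁾`. -/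
noncomputable def sandwich {k : Type*} [CommRing k] {H : Type*} [Ring H] [HopfAlgebra k H]
    (a : H) : H ⊗[k] H →ₗ[k] H :=
  LinearMap.mul' k H ∘ₗ
    LinearMap.rTensor H (LinearMap.mulRight k a ∘ₗ HopfAlgebra.antipode (R := k))

/-- `R ⊗ 1` as a map on `M ⊗ (M ⊗ M)`. -/
noncomputable def rOne {k : Type*} [CommRing k] (M : Type*) [AddCommGroup M] [Module k M]
    (R : M ⊗[k] M →ₗ[k] M ⊗[k] M) : M ⊗[k] (M ⊗[k] M) →ₗ[k] M ⊗[k] (M ⊗[k] M) :=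
  (TensorProduct.assoc k M M M).toLinearMap ∘ₗ LinearMap.rTensor M R ∘ₗ
    (TensorProduct.assoc k M M M).symm.toLinearMap

section
variable {k : Type*} [CommRing k]

/-- In a Hopf algebra, `g⁽¹⁾ * (S(g⁽²⁾) * a * g⁽³⁾) = a * g`. -/
theorem mul'_lTensor_sandwich_comul {H : Type*} [Ring H] [HopfAlgebra k H] (a g : H) :
    LinearMap.mul' k H (LinearMap.lTensor H (sandwich a ∘ₗ Coalgebra.comul (R := k))
      (Coalgebra.comul (R := k) g)) = a * g := by
  have hassoc : LinearMap.mul' k H ∘ₗ LinearMap.lTensor H (sandwich a) ∘ₗ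
      (TensorProduct.assoc k H H H).toLinearMap =
      LinearMap.mul' k H ∘ₗ LinearMap.rTensor H (LinearMap.mulRight k a ∘ₗ LinearMap.mul' k H ∘ₗ
        LinearMap.lTensor H (HopfAlgebra.antipode (R := k))) := by
    ext x y z
    simp [sandwich, mul_assoc]
  have hcounit : LinearMap.mul' k H ∘ₗ LinearMap.rTensor H (LinearMap.mulRight k a ∘ₗ
      Algebra.linearMap k H ∘ₗ Coalgebra.counit (R := k) (A := H)) =
      LinearMap.mul' k H ∘ₗ LinearMap.rTensor H (LinearMap.toSpanSingleton k H a) ∘ₗ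
        LinearMap.rTensor H (Coalgebra.counit (R := k)) := by
    ext x y
    simp [Algebra.algebraMap_eq_smul_one]
  rw [LinearMap.lTensor_comp, LinearMap.comp_apply, ← Coalgebra.coassoc_apply]
  have h := LinearMap.congr_fun hassoc
    (LinearMap.rTensor H (Coalgebra.comul (R := k)) (Coalgebra.comul (R := k) g))
  simp only [LinearMap.comp_apply, LinearEquiv.coe_coe] at h
  rw [h, ← LinearMap.comp_apply (LinearMap.rTensor _ _), ← LinearMap.rTensor_comp]
  simp only [LinearMap.comp_assoc, HopfAlgebra.mul_antipode_lTensor_comul]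
  have h' := LinearMap.congr_fun hcounit (Coalgebra.comul (R := k) g)
  simp only [LinearMap.comp_apply] at h'
  rw [h', Coalgebra.rTensor_counit_comul]
  simp

/-- For a cocommutative coalgebra, the two middle factors of the iterated comultiplication
can be exchanged. -/
theorem tensorTensorTensorComm_map_comul_comul {X : Type*} [AddCommGroup X] [Module k X]
    [Coalgebra k X] [Coalgebra.IsCocomm k X] (z : X) :
    TensorProduct.tensorTensorTensorComm k X X X X
      (TensorProduct.map (Coalgebra.comul (R := k)) (Coalgebra.comul (R := k))
        (Coalgebra.comul (R := k) z)) =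
      TensorProduct.map (Coalgebra.comul (R := k)) (Coalgebra.comul (R := k))
        (Coalgebra.comul (R := k) z) :=
  (LinearMap.congr_fun (Coalgebra.comulCoalgHom k X).map_comp_comul z).symm

theorem rOne_tmul {M : Type*} [AddCommGroup M] [Module k M]
    (R : M ⊗[k] M →ₗ[k] M ⊗[k] M) (x y z : M) :
    rOne M R (x ⊗ₜ (y ⊗ₜ z)) = TensorProduct.assoc k M M M (R (x ⊗ₜ y) ⊗ₜ z) := by
  simp [rOne]

/-- The shelf operation `x ◁ y = x · ν(y)` satisfies
`(x ◁ z⁽¹⁾) ◁ (y ◁ z⁽²⁾) = (x ◁ y) ◁ z`. -/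
theorem self_distributive_of_augmentation {H : Type*} [Ring H] [HopfAlgebra k H]
    {X : Type*} [AddCommGroup X] [Module k X] [Coalgebra k X]
    (act : X ⊗[k] H →ₗ[k] X)
    (hact_mul : ∀ (x : X) (g h : H), act (act (x ⊗ₜ g) ⊗ₜ h) = act (x ⊗ₜ (g * h)))
    (ν : X →ₗ[k] H)
    (hν_comul : (Coalgebra.comul (R := k) (A := H)) ∘ₗ ν =
      TensorProduct.map ν ν ∘ₗ Coalgebra.comul (R := k))
    (hν_aug : ∀ (x : X) (g : H), ν (act (x ⊗ₜ g)) = sandwich (ν x) (Coalgebra.comul (R := k) g))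
    (q : X ⊗[k] X →ₗ[k] X)
    (hq : ∀ x y : X, q (x ⊗ₜ y) = act (x ⊗ₜ ν y)) (x y z : X) :
    q (TensorProduct.map (q ∘ₗ TensorProduct.mk k X X x) (q ∘ₗ TensorProduct.mk k X X y)
      (Coalgebra.comul (R := k) z)) = q (q (x ⊗ₜ y) ⊗ₜ z) := by
  have h : q ∘ₗ TensorProduct.map (q ∘ₗ TensorProduct.mk k X X x) (q ∘ₗ TensorProduct.mk k X X y) =
      act ∘ₗ TensorProduct.mk k X H x ∘ₗ LinearMap.mul' k H ∘ₗ
        LinearMap.lTensor H (sandwich (ν y) ∘ₗ Coalgebra.comul (R := k)) ∘ₗ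
          TensorProduct.map ν ν := by
    ext u v
    simp [hq, hact_mul, hν_aug]
  have hz := LinearMap.congr_fun hν_comul z
  have h' := LinearMap.congr_fun h (Coalgebra.comul (R := k) z)
  simp only [LinearMap.comp_apply] at h' hz
  rw [h', ← hz, mul'_lTensor_sandwich_comul]
  simp [hq, hact_mul]

end

/-- for a categorical augmented rack `(X, H, ν)` with `X` cocommutative, the
R-matrix `R(x⊗y) = y⁽¹⁾ ⊗ (x · ν(y⁽²⁾))` satisfies the Yang–Baxter equation
`(R⊗1)∘(1⊗R)∘(R⊗1) = (1⊗R)∘(R⊗1)∘(1⊗R)` on `X⊗X⊗X`. -/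
theorem categoricalAugmentedRack_R_matrix_yang_baxter
    {k : Type*} [CommRing k] {H : Type*} [Ring H] [HopfAlgebra k H]
    {X : Type*} [AddCommGroup X] [Module k X] [Coalgebra k X]
    -- `X` is cocommutative
    (hcocomm : ∀ x : X, (TensorProduct.comm k X X) (Coalgebra.comul (R := k) x) =
      Coalgebra.comul (R := k) x)
    (act : X ⊗[k] H →ₗ[k] X)
    (hact_one : ∀ x : X, act (x ⊗ₜ (1 : H)) = x)
    (hact_mul : ∀ (x : X) (g h : H), act (act (x ⊗ₜ g) ⊗ₜ h) = act (x ⊗ₜ (g * h)))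
    (hcompat : (Coalgebra.comul (R := k) (A := X)) ∘ₗ act =
      TensorProduct.map act act ∘ₗ (TensorProduct.tensorTensorTensorComm k X X H H).toLinearMap
        ∘ₗ TensorProduct.map (Coalgebra.comul (R := k)) (Coalgebra.comul (R := k)))
    (hcounit : ∀ (x : X) (g : H),
      Coalgebra.counit (R := k) (act (x ⊗ₜ g)) =
        Coalgebra.counit (R := k) x * Coalgebra.counit (R := k) g)
    (ν : X →ₗ[k] H)
    (hν_comul : (Coalgebra.comul (R := k) (A := H)) ∘ₗ ν =
      TensorProduct.map ν ν ∘ₗ Coalgebra.comul (R := k))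
    (hν_counit : (Coalgebra.counit (R := k) (A := H)) ∘ₗ ν = Coalgebra.counit (R := k))
    (hν_aug : ∀ (x : X) (g : H), ν (act (x ⊗ₜ g)) = sandwich (ν x) (Coalgebra.comul (R := k) g))
    (q : X ⊗[k] X →ₗ[k] X)
    (hq : ∀ x y : X, q (x ⊗ₜ y) = act (x ⊗ₜ ν y))
    -- the R-matrix `R(x ⊗ y) = y⁽¹⁾ ⊗ q(x ⊗ y⁽²⁾)`
    (R : X ⊗[k] X →ₗ[k] X ⊗[k] X)
    (hR : ∀ x y : X, R (x ⊗ₜ y) =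
      LinearMap.lTensor X q
        ((TensorProduct.leftComm k X X X) (x ⊗ₜ Coalgebra.comul (R := k) y))) :
    rOne X R ∘ₗ LinearMap.lTensor X R ∘ₗ rOne X R =
      LinearMap.lTensor X R ∘ₗ rOne X R ∘ₗ LinearMap.lTensor X R := by
  have : Coalgebra.IsCocomm k X := ⟨LinearMap.ext hcocomm⟩
  set P : X → X →ₗ[k] X := fun a => q ∘ₗ TensorProduct.mk k X X a with hP
  have hRP (x y : X) : R (x ⊗ₜ y) = LinearMap.lTensor X (P x) (Coalgebra.comul (R := k) y) := by
    rw [hR]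
    generalize Coalgebra.comul (R := k) y = t
    induction t with
    | zero => simp
    | add s t hs ht => simp only [tmul_add, map_add, hs, ht]
    | tmul u v => simp [hP]
  have hdist (x y : X) : (q ∘ₗ TensorProduct.map (P x) (P y)) ∘ₗ Coalgebra.comul (R := k) =
      P (q (x ⊗ₜ y)) := by
    ext z
    exact self_distributive_of_augmentation act hact_mul ν hν_comul hν_aug q hq x y z
  have hcomul (y d : X) {ι : Type _} (ry : Coalgebra.Repr k y ι) :
      Coalgebra.comul (R := k) (q (y ⊗ₜ d)) = ∑ i ∈ ry.index,
        TensorProduct.map (P (ry.left i)) (P (ry.right i)) (Coalgebra.comul (R := k) d) := by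
    have h := LinearMap.congr_fun hcompat (y ⊗ₜ ν d)
    have hd := LinearMap.congr_fun hν_comul d
    simp only [LinearMap.comp_apply, TensorProduct.map_tmul, LinearEquiv.coe_coe] at h hd
    rw [hq, h, hd, ← ry.eq]
    generalize Coalgebra.comul (R := k) d = t
    induction t with
    | zero => simp
    | add s t hs ht => simp only [tmul_add, map_add, hs, ht, Finset.sum_add_distrib]
    | tmul u v => simp [hP, hq, sum_tmul]
  ext x y z
  let ry := Coalgebra.Repr.arbitrary k y
  have hleft (a w : X) : rOne X R (a ⊗ₜ R (w ⊗ₜ z)) =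
      TensorProduct.assoc k X X X (TensorProduct.map (LinearMap.lTensor X (P a)) (P w)
        (LinearMap.rTensor X (Coalgebra.comul (R := k)) (Coalgebra.comul (R := k) z))) := by
    rw [hRP]
    generalize Coalgebra.comul (R := k) z = t
    induction t with
    | zero => simp
    | add s t hs ht => simp only [tmul_add, map_add, hs, ht]
    | tmul u v => simp [rOne_tmul, hRP]
  have hright : LinearMap.lTensor X R (rOne X R (x ⊗ₜ R (y ⊗ₜ z))) = ∑ i ∈ ry.index,
      TensorProduct.assoc k X X X (TensorProduct.map (LinearMap.lTensor X (P (ry.left i)))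
        (q ∘ₗ TensorProduct.map (P x) (P (ry.right i)))
        (TensorProduct.tensorTensorTensorComm k X X X X
          (TensorProduct.map (Coalgebra.comul (R := k)) (Coalgebra.comul (R := k))
            (Coalgebra.comul (R := k) z)))) := by
    rw [hRP]
    generalize Coalgebra.comul (R := k) z = t
    induction t with
    | zero => simp
    | add s t hs ht => simp only [tmul_add, map_add, hs, ht, Finset.sum_add_distrib]
    | tmul c d =>
      simp only [LinearMap.lTensor_tmul, TensorProduct.map_tmul, rOne_tmul]
      rw [hRP]
      generalize Coalgebra.comul (R := k) c = s
      induction s with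
      | zero => simp
      | add s t hs ht => simp only [add_tmul, map_add, hs, ht, Finset.sum_add_distrib]
      | tmul u v =>
        have hd : P y d = q (y ⊗ₜ d) := rfl
        simp only [LinearMap.lTensor_tmul, TensorProduct.assoc_tmul, hRP, hd, hcomul y d ry]
        rw [map_sum, tmul_sum]
        refine Finset.sum_congr rfl fun i _ => ?_
        generalize Coalgebra.comul (R := k) d = r
        induction r with
        | zero => simp
        | add s t hs ht => simp only [tmul_add, map_add, hs, ht]
        | tmul d e => simp [hP]
  simp only [AlgebraTensorModule.curry_apply, curry_apply, LinearMap.coe_restrictScalars,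
    LinearMap.comp_apply, LinearMap.lTensor_tmul]
  rw [hright, rOne_tmul, hRP, ← ry.eq]
  simp only [map_sum, sum_tmul, LinearMap.lTensor_tmul, TensorProduct.assoc_tmul, hleft]
  refine Finset.sum_congr rfl fun i _ => ?_
  rw [tensorTensorTensorComm_map_comul_comul]
  have hPx : P x (ry.right i) = q (x ⊗ₜ ry.right i) := rfl
  rw [hPx, ← hdist]
  simp only [LinearMap.rTensor, TensorProduct.map_map, LinearMap.comp_id]
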